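/- arXiv:math/0308081 — 12 statements merged into one kernel-verified Lean document; each statement's English description precedes it below -/
import Mathlib

section
/- Let T be an n×n tableau over a finite alphabet A and suppose some letter a ∈ A occurs at least n²−n+1 times among the entries of T. Then the constant word a^n (the word whose every letter is a) belongs to both L(T) and Perm(T); in particular T is non-Cantorian. -/
/-- The permanent of a finite tableau. -/
def TPerm {n : ℕ} {A : Type*} (T : Fin n → Fin n → A) : Set (Fin n → A) :=
  {w | ∃ π : Equiv.Perm (Fin n), ∀ j, w j = T (π j) j}

/-- If a letter `a` occurs at least `n² - n + 1` times among the entries of an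
`n × n` tableau `T`, then the constant word `aⁿ` is both a row-word of `T` and an
element of `Perm T`; in particular `T` is non-Cantorian. -/
theorem const_mem_of_many_occurrences {n : ℕ} {A : Type*} [Fintype A] [DecidableEq A]
    (hn : 1 ≤ n) (T : Fin n → Fin n → A) (a : A)
    (hcount : n ^ 2 - n + 1 ≤
      (Finset.univ.filter (fun p : Fin n × Fin n => T p.1 p.2 = a)).card) :
    (fun _ : Fin n => a) ∈ Set.range (fun i => T i) ∧ (fun _ : Fin n => a) ∈ TPerm T := by
  haveI : NeZero n := ⟨by omega⟩
  have hbad : (Finset.univ.filter (fun p : Fin n × Fin n => ¬ T p.1 p.2 = a)).card < n := by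
    have h := Finset.card_filter_add_card_filter_not (s := (Finset.univ : Finset (Fin n × Fin n)))
      (fun p : Fin n × Fin n => T p.1 p.2 = a)
    have h2 : (Finset.univ : Finset (Fin n × Fin n)).card = n ^ 2 := by
      simp [sq]
    have h3 : n ≤ n ^ 2 := Nat.le_self_pow (by norm_num) n
    omega
  have key : ∀ f : Fin n × Fin n → Fin n, ∃ k, ∀ p, f p = k → T p.1 p.2 = a := by
    intro f
    by_contra hcon
    push Not at hcon
    have hsub : (Finset.univ : Finset (Fin n)) ⊆
        (Finset.univ.filter (fun p : Fin n × Fin n => ¬ T p.1 p.2 = a)).image f := by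
      intro k _
      obtain ⟨p, hp, hpa⟩ := hcon k
      exact Finset.mem_image.2 ⟨p, by simpa using hpa, hp⟩
    have h1 := Finset.card_le_card hsub
    have h2 := h1.trans Finset.card_image_le
    rw [Finset.card_univ, Fintype.card_fin] at h2
    omega
  constructor
  · obtain ⟨k, hk⟩ := key Prod.fst
    exact ⟨k, funext fun j => hk (k, j) rfl⟩
  · obtain ⟨k, hk⟩ := key (fun p => p.1 - p.2)
    exact ⟨Equiv.addLeft k, fun j => (hk (k + j, j) (by simp)).symm⟩
end

section
/- Let T be an n×n tableau over a finite alphabet A with row-words l_1,…,l_n, let σ_1,…,σ_n : A → A be fixed-point-free maps, and let σ̄T be the n×n tableau whose i-th row-word is σ_i ∘ l_i. Then Perm(σ̄T) is disjoint from the set L(T) of row-words of T. -/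
/-- If `σ₁, …, σₙ : A → A` are fixed-point-free maps and `σ̄T` is the tableau whose
`i`-th row-word is `σᵢ ∘ lᵢ`, then `Perm (σ̄T)` is disjoint from the set of
row-words of `T`. -/
theorem perm_sigma_tableau_disjoint_rows {n : ℕ} {A : Type*} [Fintype A] (hn : 1 ≤ n)
    (T : Fin n → Fin n → A) (σ : Fin n → A → A)
    (hσ : ∀ i : Fin n, ∀ a : A, σ i a ≠ a) :
    TPerm (fun i j : Fin n => σ i (T i j)) ∩ Set.range (fun i : Fin n => T i) = ∅ := by
  rw [Set.eq_empty_iff_forall_notMem]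
  rintro w ⟨⟨π, hπ⟩, i, rfl⟩
  have h := hπ (π.symm i)
  simp only [Equiv.apply_symm_apply] at h
  exact hσ i _ h.symm
end

section
/- Let T be an n×n tableau over a finite alphabet A with row-words l_1,…,l_n, and let σ_1,…,σ_n : A → A be fixed-point-free maps. If the set {σ_i ∘ l_i : 1 ≤ i ≤ n} equals the set L(T) of row-words of T, then T is Cantorian. -/
/-- A tableau is Cantorian if no row-word belongs to its permanent. -/
def Cantorian {n : ℕ} {A : Type*} (T : Fin n → Fin n → A) : Prop :=
  Set.range (fun i => T i) ∩ TPerm T = ∅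

/-- If `σ₁, …, σₙ : A → A` are fixed-point-free maps and the set
`{σᵢ ∘ lᵢ : 1 ≤ i ≤ n}` equals the set of row-words of `T`, then `T` is Cantorian. -/
theorem cantorian_of_sigma_invariant {n : ℕ} {A : Type*} [Fintype A] (hn : 1 ≤ n)
    (T : Fin n → Fin n → A) (σ : Fin n → A → A)
    (hσ : ∀ i : Fin n, ∀ a : A, σ i a ≠ a)
    (hinv : Set.range (fun i : Fin n => σ i ∘ T i) = Set.range (fun i : Fin n => T i)) :
    Cantorian T := by
  rw [Cantorian, Set.eq_empty_iff_forall_notMem]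
  rintro w ⟨hw, π, hπ⟩
  rw [← hinv] at hw
  obtain ⟨i, hi⟩ := hw
  have h1 := hπ (π.symm i)
  rw [Equiv.apply_symm_apply] at h1
  have h2 := congrFun hi (π.symm i)
  simp only [Function.comp_apply] at h2
  exact hσ i _ (h2.trans h1)
end

section
/- Let T be an n×n tableau over a finite alphabet A. If for every row index i there exists a row index i' such that a_i^j ≠ a_{i'}^j for all columns j, then T is Cantorian. -/
/-- If for every row `i` there is a row `i'` differing from it in every column,
then the tableau is Cantorian. -/
theorem cantorian_of_opposite_rows {n : ℕ} {A : Type*} [Fintype A] (hn : 1 ≤ n)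
    (T : Fin n → Fin n → A)
    (h : ∀ i : Fin n, ∃ i' : Fin n, ∀ j : Fin n, T i j ≠ T i' j) :
    Cantorian T := by
  unfold Cantorian
  rw [Set.eq_empty_iff_forall_notMem]
  rintro w ⟨⟨i, rfl⟩, π, hπ⟩
  obtain ⟨i', hi⟩ := h i
  apply hi (π.symm i')
  have := hπ (π.symm i')
  rwa [Equiv.apply_symm_apply] at this
end

section
/- Let W be a nonempty set of m distinct words of length n over a finite alphabet A, with m ≤ n, and let σ : A → A be a map such that σ(w) ∈ W for every w ∈ W (σ applied letterwise). If W ∩ Perm(W) ≠ ∅, then σ has a fixed point: there exists a letter a ∈ A with σ(a) = a. -/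
/-- The permanent of a finite set `W` of words of length `n`: the union of the
permanents of all `n × n` tableaux whose set of row-words is exactly `W`. -/
def WPerm {n : ℕ} {A : Type*} (W : Finset (Fin n → A)) : Set (Fin n → A) :=
  ⋃ T ∈ {T : Fin n → Fin n → A | Set.range (fun i => T i) = (W : Set (Fin n → A))},
    TPerm T

/-- Fixed point theorem: if `W` is a nonempty set of `m ≤ n` words of length `n`,
`σ : A → A` maps `W` into itself letterwise, and `W ∩ Perm W ≠ ∅`, then `σ` has a
fixed point. -/
theorem exists_fixed_point {n m : ℕ} {A : Type*} [Fintype A]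
    (hm : 1 ≤ m) (hmn : m ≤ n) (W : Finset (Fin n → A)) (hW : W.card = m)
    (σ : A → A) (hσW : ∀ w ∈ W, σ ∘ w ∈ W)
    (hinter : ∃ w ∈ W, w ∈ WPerm W) :
    ∃ a : A, σ a = a := by
  obtain ⟨w, hw, hp⟩ := hinter
  simp only [WPerm, TPerm, Set.mem_iUnion, Set.mem_setOf_eq] at hp
  obtain ⟨T, hT, π, hπ⟩ := hp
  have h1 : σ ∘ w ∈ Set.range (fun i => T i) := by
    rw [hT]
    exact hσW w hw
  obtain ⟨i, hi⟩ := h1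
  refine ⟨w (π.symm i), ?_⟩
  have h2 := congrFun hi (π.symm i)
  have h3 := hπ (π.symm i)
  rw [Equiv.apply_symm_apply] at h3
  exact (h3.trans h2).symm
end

section
/- Let c(n,p) denote the number of Cantorian n×n tableaux over the two-letter alphabet {0,1} having exactly p entries equal to 1. Then c(n,p) = 0 whenever p < n, and c(n,n) = n for every n ≥ 3. -/
/-- The number of entries of a `{0,1}`-tableau equal to `1`. -/
def onesCount {n : ℕ} (T : Fin n → Fin n → Fin 2) : ℕ :=
  (Finset.univ.filter (fun p : Fin n × Fin n => T p.1 p.2 = 1)).card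

/-- `c n p` is the number of Cantorian `n × n` tableaux over `{0,1}` with exactly
`p` entries equal to `1`. -/
noncomputable def c (n p : ℕ) : ℕ :=
  Nat.card {T : Fin n → Fin n → Fin 2 // Cantorian T ∧ onesCount T = p}

theorem hall_avoid {α β : Type*} [Fintype α] [Fintype β] [DecidableEq α] [DecidableEq β]
    (hc : Fintype.card α = Fintype.card β) (B : Finset (α × β))
    (hB : B.card ≤ Fintype.card α)
    (hr : ∀ a, ∃ b, (a, b) ∉ B) (hcol : ∀ b, ∃ a, (a, b) ∉ B) :
    ∃ σ : α → β, Function.Injective σ ∧ ∀ a, (a, σ a) ∉ B := by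
  classical
  let t : α → Finset β := fun a => Finset.univ.filter (fun b => (a, b) ∉ B)
  have key : ∀ s : Finset α, s.card ≤ (s.biUnion t).card := by
    intro s
    by_contra hlt
    push Not at hlt
    set U := s.biUnion t with hU
    have hsub : s ×ˢ Uᶜ ⊆ B := by
      rintro ⟨a, b⟩ hab
      simp only [Finset.mem_product, Finset.mem_compl] at hab
      by_contra hn
      exact hab.2 (Finset.mem_biUnion.2 ⟨a, hab.1, by simp [t, hn]⟩)
    have h1 := Finset.card_le_card hsub
    rw [Finset.card_product] at h1
    have h2 : Uᶜ.card + U.card = Fintype.card β := by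
      rw [add_comm]; exact Finset.card_add_card_compl U
    have h3 : s.card ≤ Fintype.card α := Finset.card_le_univ s
    have hpos : 1 ≤ s.card := by omega
    have h4 : s.card = 1 ∨ s.card = Fintype.card α := by
      by_contra hcon
      push Not at hcon
      obtain ⟨d, hd⟩ : ∃ d, s.card = d + 2 := ⟨s.card - 2, by omega⟩
      obtain ⟨e, he⟩ : ∃ e, Fintype.card α = d + 3 + e := ⟨Fintype.card α - (d+3), by omega⟩
      have h5 : e + 2 ≤ Uᶜ.card := by omega
      have h6 : (d + 2) * (e + 2) ≤ s.card * Uᶜ.card := by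
        rw [hd]; exact Nat.mul_le_mul_left _ h5
      nlinarith
    rcases h4 with h4 | h4
    · obtain ⟨a, rfl⟩ := Finset.card_eq_one.1 h4
      obtain ⟨b, hb⟩ := hr a
      have : b ∈ U := Finset.mem_biUnion.2 ⟨a, by simp, by simp [t, hb]⟩
      have := Finset.card_pos.2 ⟨b, this⟩
      omega
    · have hs : s = Finset.univ := (Finset.card_eq_iff_eq_univ s).1 h4
      have : 0 < Uᶜ.card := by omega
      obtain ⟨b, hb⟩ := Finset.card_pos.1 this
      obtain ⟨a, ha⟩ := hcol b
      exact (Finset.mem_compl.1 hb)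
        (Finset.mem_biUnion.2 ⟨a, by simp [hs], by simp [t, ha]⟩)
  obtain ⟨σ, h1, h2⟩ := (Finset.all_card_le_biUnion_card_iff_exists_injective t).1 key
  exact ⟨σ, h1, fun a => by simpa [t] using h2 a⟩

theorem not_cantorian_of {n : ℕ} (T : Fin n → Fin n → Fin 2) (i : Fin n)
    (σ : Fin n → Fin n) (hσ : Function.Injective σ) (h : ∀ k, T k (σ k) = T i (σ k)) :
    ¬ Cantorian T := by
  intro hC
  let e := Equiv.ofBijective σ (Finite.injective_iff_bijective.1 hσ)
  have : T i ∈ Set.range (fun i => T i) ∩ TPerm T := by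
    refine ⟨⟨i, rfl⟩, e.symm, fun j => ?_⟩
    have := h (e.symm j)
    have h2 : σ (e.symm j) = j := e.apply_symm_apply j
    rw [h2] at this
    exact this.symm
  rw [hC] at this
  exact this

theorem fin2_ne_one {x : Fin 2} (h : x ≠ 1) : x = 0 := by omega

theorem not_cantorian_zero_row {n : ℕ} (T : Fin n → Fin n → Fin 2) (hp : onesCount T ≤ n)
    (i : Fin n) (hi : ∀ j, T i j = 0) (hr : ∀ a, ∃ b, T a b ≠ 1) : ¬ Cantorian T := by
  obtain ⟨σ, h1, h2⟩ := hall_avoid (α := Fin n) (β := Fin n) rfl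
    (Finset.univ.filter (fun p : Fin n × Fin n => T p.1 p.2 = 1))
    (by simpa [onesCount] using hp) (by simpa using hr)
    (fun b => ⟨i, by simp [hi]⟩)
  refine not_cantorian_of T i σ h1 fun k => ?_
  rw [hi]
  exact fin2_ne_one (by simpa using h2 k)

theorem ones_eq {n : ℕ} (T : Fin n → Fin n → Fin 2) (g : Fin n → Fin n × Fin n)
    (hg : Function.Injective g) (h : ∀ k, T (g k).1 (g k).2 = 1) :
    n ≤ onesCount T ∧ (onesCount T = n → ∀ a b, T a b = 1 → ∃ k, g k = (a, b)) := by
  have hs : Finset.univ.image g ⊆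
      Finset.univ.filter (fun p : Fin n × Fin n => T p.1 p.2 = 1) := by
    intro x hx
    obtain ⟨k, -, rfl⟩ := Finset.mem_image.1 hx
    simp [h]
  have hcard : (Finset.univ.image g).card = n := by
    rw [Finset.card_image_of_injective _ hg]; simp
  refine ⟨?_, fun hn a b hab => ?_⟩
  · have := Finset.card_le_card hs
    rw [hcard] at this
    exact this
  · have := Finset.eq_of_subset_of_card_le hs (by rw [hcard]; exact hn.le)
    have hm : (a, b) ∈ Finset.univ.image g := by rw [this]; simp [hab]
    simpa using hm

theorem not_cantorian_fun {n : ℕ} (hn : 3 ≤ n) (T : Fin n → Fin n → Fin 2)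
    (f : Fin n → Fin n) (hf : ∀ i j, T i j = 1 ↔ f i = j) : ¬ Cantorian T := by
  classical
  obtain ⟨i, hi⟩ : ∃ i, ∀ j, j ≠ f i → ∃ k, k ≠ i ∧ f k ≠ j := by
    by_contra hcon
    push Not at hcon
    obtain ⟨j, hj, hj'⟩ := hcon ⟨0, by omega⟩
    obtain ⟨j2, hj2, hj2'⟩ := hcon ⟨1, by omega⟩
    have e1 := hj' ⟨1, by omega⟩ (by simp)
    have e2 := hj' ⟨2, by omega⟩ (by simp)
    have e3 := hj2' ⟨2, by omega⟩ (by simp)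
    exact hj2 (by rw [← e3, e2, e1])
  have hca : Fintype.card {k // k ≠ i} = n - 1 := by simp
  have hcb : Fintype.card {j // j ≠ f i} = n - 1 := by simp
  obtain ⟨g, hg, hg2⟩ := hall_avoid (α := {k // k ≠ i}) (β := {j // j ≠ f i})
    (by rw [hca, hcb])
    (Finset.univ.filter (fun p => f p.1.1 = p.2.1))
    (by
      rw [← Finset.card_univ]
      refine Finset.card_le_card_of_injOn Prod.fst (by simp) ?_
      rintro ⟨a, b⟩ h1 ⟨a', b'⟩ h2 h3
      simp only [Finset.coe_filter, Finset.mem_univ, true_and, Set.mem_ofPred_eq] at h1 h2 h3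
      subst h3
      rw [Prod.mk.injEq]
      exact ⟨rfl, Subtype.ext (h1.symm.trans h2)⟩)
    (by
      intro a
      have : Nontrivial {j // j ≠ f i} := Fintype.one_lt_card_iff_nontrivial.1 (by omega)
      obtain ⟨x, y, hxy⟩ := this
      by_cases hx : f a.1 = x.1
      · refine ⟨y, ?_⟩
        simp only [Finset.mem_filter, Finset.mem_univ, true_and]
        intro hy
        exact hxy (Subtype.ext (hx.symm.trans hy))
      · exact ⟨x, by simpa using hx⟩)
    (by
      rintro ⟨b, hb⟩
      obtain ⟨k, hk, hk'⟩ := hi b hb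
      exact ⟨⟨k, hk⟩, by simpa using hk'⟩)
  let σ : Fin n → Fin n := fun k => if h : k = i then f i else (g ⟨k, h⟩).1
  have s1 : σ i = f i := by simp [σ]
  have s2 : ∀ k (h : k ≠ i), σ k = (g ⟨k, h⟩).1 := fun k h => by simp [σ, h]
  refine not_cantorian_of T i σ ?_ ?_
  · intro a b hab
    by_cases ha : a = i <;> by_cases hb : b = i
    · rw [ha, hb]
    · rw [ha, s1, s2 b hb] at hab
      exact absurd hab.symm (g ⟨b, hb⟩).2
    · rw [hb, s1, s2 a ha] at hab
      exact absurd hab (g ⟨a, ha⟩).2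
    · rw [s2 a ha, s2 b hb] at hab
      exact congrArg Subtype.val (hg (Subtype.ext hab))
  · intro k
    by_cases hk : k = i
    · rw [hk]
    · have h1 : T k (σ k) ≠ 1 := by
        rw [Ne, hf, s2 k hk]; simpa using hg2 ⟨k, hk⟩
      have h2 : T i (σ k) ≠ 1 := by
        rw [Ne, hf, s2 k hk]; exact fun h => (g ⟨k, hk⟩).2 h.symm
      rw [fin2_ne_one h1, fin2_ne_one h2]

theorem full_row {n : ℕ} (T : Fin n → Fin n → Fin 2) (a : Fin n) (h : ∀ b, T a b = 1) :
    n ≤ onesCount T ∧ (onesCount T = n → T = fun i _ => if i = a then 1 else 0) := by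
  obtain ⟨h1, h2⟩ := ones_eq T (fun b => (a, b)) (fun x y h => by simpa using h) h
  refine ⟨h1, fun hn => ?_⟩
  funext i j
  by_cases hia : i = a
  · simp [hia, h]
  · simp only [hia, if_false]
    apply fin2_ne_one
    intro hT
    obtain ⟨k, hk⟩ := h2 hn i j hT
    exact hia (by simpa using (congrArg Prod.fst hk).symm)

theorem row_good {n : ℕ} (hn : 3 ≤ n) (a : Fin n) :
    Cantorian (fun (i _ : Fin n) => if i = a then (1 : Fin 2) else 0) ∧
    onesCount (fun (i _ : Fin n) => if i = a then (1 : Fin 2) else 0) = n := by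
  constructor
  · rw [Cantorian, Set.eq_empty_iff_forall_notMem]
    rintro w ⟨⟨i, rfl⟩, π, hπ⟩
    simp only at hπ
    have h0 := hπ (π.symm a)
    simp only [Equiv.apply_symm_apply, if_true] at h0
    have hia : i = a := by
      by_contra h
      simp [h] at h0
    have : Nontrivial (Fin n) := Fin.nontrivial_iff_two_le.2 (by omega)
    obtain ⟨b, hb⟩ := exists_ne a
    have h1 := hπ (π.symm b)
    simp [hia, hb] at h1
  · have : (Finset.univ.filter (fun p : Fin n × Fin n =>
        (if p.1 = a then (1 : Fin 2) else 0) = 1)) = Finset.univ.image (fun b => (a, b)) := by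
      ext ⟨x, y⟩
      by_cases hx : x = a <;> simp [hx, eq_comm]
    rw [onesCount, this, Finset.card_image_of_injective _ (fun x y h => by simpa using h)]
    simp

/-- `c (n, p) = 0` for `p < n`, and `c (n, n) = n` for `n ≥ 3`. -/
theorem c_small_p (n p : ℕ) :
    (p < n → c n p = 0) ∧ (3 ≤ n → c n n = n) := by
  constructor
  · intro hp
    have : IsEmpty {T : Fin n → Fin n → Fin 2 // Cantorian T ∧ onesCount T = p} := by
      constructor
      rintro ⟨T, hC, hT⟩
      by_cases hz : ∃ i, ∀ j, T i j = 0
      · obtain ⟨i, hi⟩ := hz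
        refine not_cantorian_zero_row T (by omega) i hi ?_ hC
        intro a
        by_contra hcon
        push Not at hcon
        have := (full_row T a hcon).1
        omega
      · push Not at hz
        choose f hf using hz
        have := (ones_eq T (fun k => (k, f k)) (fun x y h => by simpa using congrArg Prod.fst h)
          (fun k => by have := hf k; simp only; omega)).1
        omega
    rw [c, Nat.card_of_isEmpty]
  · intro hn
    let F : Fin n → {T : Fin n → Fin n → Fin 2 // Cantorian T ∧ onesCount T = n} :=
      fun a => ⟨fun i _ => if i = a then 1 else 0, row_good hn a⟩
    have hF : Function.Bijective F := by
      constructor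
      · intro a b hab
        have := congrFun (congrFun (congrArg Subtype.val hab) a) a
        by_contra h
        simp [F, h] at this
      · rintro ⟨T, hC, hT⟩
        by_cases hr : ∀ a, ∃ b, T a b ≠ 1
        · exfalso
          by_cases hz : ∃ i, ∀ j, T i j = 0
          · obtain ⟨i, hi⟩ := hz
            exact not_cantorian_zero_row T hT.le i hi hr hC
          · push Not at hz
            choose f hf using hz
            have hf1 : ∀ k, T k (f k) = 1 := fun k => by have := hf k; omega
            have := (ones_eq T (fun k => (k, f k))
              (fun x y h => by simpa using congrArg Prod.fst h) hf1).2 hT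
            refine not_cantorian_fun hn T f (fun i j => ⟨fun h => ?_, fun h => h ▸ hf1 i⟩) hC
            obtain ⟨k, hk⟩ := this i j h
            rw [Prod.mk.injEq] at hk
            rw [← hk.1, hk.2]
        · push Not at hr
          obtain ⟨a, ha⟩ := hr
          exact ⟨a, Subtype.ext ((full_row T a ha).2 hT).symm⟩
    rw [c, ← Nat.card_congr (Equiv.ofBijective F hF)]
    simp
end

section
/- Let c(n,p) denote the number of Cantorian n×n tableaux over the two-letter alphabet {0,1} having exactly p entries equal to 1. Then c(n,n+1) = 0 for every n ≥ 4, and c(n,n+2) = 0 for every n ≥ 5. -/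
theorem hallPerm {n : ℕ} (t : Fin n → Finset (Fin n))
    (h : ¬ ∃ π : Equiv.Perm (Fin n), ∀ j, π j ∈ t j) :
    ∃ S B : Finset (Fin n), n + 1 ≤ S.card + B.card ∧ ∀ r ∈ B, ∀ k ∈ S, r ∉ t k := by
  by_contra hc
  apply h
  have hall : ∀ S : Finset (Fin n), S.card ≤ (S.biUnion t).card := by
    intro S
    by_contra hS
    apply hc
    refine ⟨S, (S.biUnion t)ᶜ, ?_, ?_⟩
    · have := Finset.card_add_card_compl (S.biUnion t)
      rw [Fintype.card_fin] at this
      omega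
    · intro r hr k hk hrk
      rw [Finset.mem_compl] at hr
      exact hr (Finset.mem_biUnion.2 ⟨k, hk, hrk⟩)
  obtain ⟨f, hf, hft⟩ := (Finset.all_card_le_biUnion_card_iff_exists_injective t).1 hall
  exact ⟨Equiv.ofBijective f (Finite.injective_iff_bijective.1 hf), fun j => hft j⟩

def rowSum {n : ℕ} (T : Fin n → Fin n → Fin 2) (r : Fin n) : ℕ :=
  (Finset.univ.filter (fun k => T r k = 1)).card

theorem onesCount_eq {n : ℕ} (T : Fin n → Fin n → Fin 2) :
    onesCount T = ∑ r, rowSum T r := by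
  unfold onesCount rowSum
  simp only [Finset.card_filter]
  rw [Fintype.sum_prod_type]

theorem fin2_ne {x : Fin 2} (h : x ≠ 0) : x = 1 := by omega

theorem cant_no_perm {n : ℕ} {T : Fin n → Fin n → Fin 2} (hT : Cantorian T) (i : Fin n) :
    ¬ ∃ π : Equiv.Perm (Fin n), ∀ j, T i j = T (π j) j := by
  intro h
  have : T i ∈ Set.range (fun i => T i) ∩ TPerm T := ⟨⟨i, rfl⟩, h⟩
  rw [hT] at this
  exact this

theorem lemX {n : ℕ} {T : Fin n → Fin n → Fin 2} (hT : Cantorian T) (i f j : Fin n)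
    (hi : ∀ k, T i k = 1 ↔ k = j) (hf : T f j = 1) :
    ∃ S B : Finset (Fin n), n ≤ S.card + B.card ∧ f ∉ B ∧ j ∉ S ∧ 1 ≤ S.card ∧ 1 ≤ B.card ∧
      ∀ r ∈ B, ∀ k ∈ S, T r k = 1 := by
  classical
  have key : ∃ S B : Finset (Fin n), n ≤ S.card + B.card ∧ f ∉ B ∧ j ∉ S ∧
      ∀ r ∈ B, ∀ k ∈ S, T r k = 1 := by
    let t : Fin n → Finset (Fin n) := fun k =>
      if k = j then {f} else Finset.univ.filter (fun r => T r k = 0)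
    have hno : ¬ ∃ π : Equiv.Perm (Fin n), ∀ k, π k ∈ t k := by
      rintro ⟨π, hπ⟩
      apply cant_no_perm hT i
      refine ⟨π, fun k => ?_⟩
      have h1 := hπ k
      by_cases hk : k = j
      · subst hk
        simp only [t, if_true, Finset.mem_singleton] at h1
        rw [h1, hf]
        exact (hi _).2 rfl
      · simp only [t, if_neg hk, Finset.mem_filter, Finset.mem_univ, true_and] at h1
        rw [h1]
        have := mt (hi k).1 hk
        omega
    obtain ⟨S, B, hc, hb⟩ := hallPerm t hno
    have hone : ∀ r ∈ B, ∀ k ∈ S, k ≠ j → T r k = 1 := by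
      intro r hr k hk hkj
      have := hb r hr k hk
      simp only [t, if_neg hkj, Finset.mem_filter, Finset.mem_univ, true_and] at this
      exact fin2_ne this
    by_cases hj : j ∈ S
    · refine ⟨S.erase j, B, ?_, ?_, by simp, ?_⟩
      · rw [Finset.card_erase_of_mem hj]; omega
      · intro hfB
        have := hb f hfB j hj
        simp [t] at this
      · intro r hr k hk
        rw [Finset.mem_erase] at hk
        exact hone r hr k hk.2 hk.1
    · refine ⟨S, B.erase f, ?_, by simp, hj, ?_⟩
      · have := Finset.pred_card_le_card_erase (s := B) (a := f); omega
      · intro r hr k hk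
        exact hone r (Finset.mem_of_mem_erase hr) k hk (fun h => hj (h ▸ hk))
  obtain ⟨S, B, h1, h2, h3, h4⟩ := key
  have hS : S.card < n := by
    simpa using Finset.card_lt_univ_of_notMem h3
  have hB : B.card < n := by
    simpa using Finset.card_lt_univ_of_notMem h2
  exact ⟨S, B, h1, h2, h3, by omega, by omega, h4⟩

theorem rowSum_ge {n : ℕ} {T : Fin n → Fin n → Fin 2} {r : Fin n} {S : Finset (Fin n)}
    (h : ∀ k ∈ S, T r k = 1) : S.card ≤ rowSum T r := by
  apply Finset.card_le_card
  intro k hk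
  simpa using h k hk

theorem block_le {n : ℕ} {T : Fin n → Fin n → Fin 2} {S B : Finset (Fin n)}
    (h : ∀ r ∈ B, ∀ k ∈ S, T r k = 1) : B.card * S.card ≤ ∑ r ∈ B, rowSum T r := by
  have := Finset.card_nsmul_le_sum B (rowSum T) S.card (fun r hr => rowSum_ge (h r hr))
  simpa using this

theorem rowSum_one {n : ℕ} {T : Fin n → Fin n → Fin 2} {r : Fin n} (h : rowSum T r = 1) :
    ∃ j, ∀ k, T r k = 1 ↔ k = j := by
  obtain ⟨j, hj⟩ := Finset.card_eq_one.1 h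
  refine ⟨j, fun k => ?_⟩
  have := Finset.ext_iff.1 hj k
  simpa using this

theorem case_full {n d : ℕ} {T : Fin n → Fin n → Fin 2} (hT : Cantorian T)
    (hd1 : 1 ≤ d) (hd2 : d ≤ 2) (hn : d + 3 ≤ n) (hs : onesCount T = n + d)
    (f : Fin n) (hf : ∀ k, T f k = 1) : False := by
  classical
  rw [onesCount_eq, ← Finset.add_sum_erase _ _ (Finset.mem_univ f)] at hs
  have hfs : rowSum T f = n := by simp [rowSum, hf]
  have hs' : ∑ r ∈ Finset.univ.erase f, rowSum T r = d := by omega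
  have hex : ∃ i ∈ Finset.univ.erase f, rowSum T i ≠ 0 := by
    by_contra hc
    push Not at hc
    rw [Finset.sum_eq_zero hc] at hs'
    omega
  obtain ⟨i, hi, hi0⟩ := hex
  have hle : rowSum T i + ∑ r ∈ (Finset.univ.erase f).erase i, rowSum T r = d := by
    rw [Finset.add_sum_erase _ _ hi, hs']
  by_cases h1 : rowSum T i = 1
  · obtain ⟨j, hj⟩ := rowSum_one h1
    obtain ⟨S, B, hc, hfB, -, hS, hB, hb⟩ := lemX hT i f j hj (hf j)
    have h2 := block_le hb
    have h3 : ∑ r ∈ B, rowSum T r ≤ ∑ r ∈ Finset.univ.erase f, rowSum T r := by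
      apply Finset.sum_le_sum_of_subset
      intro r hr
      simp only [Finset.mem_erase, Finset.mem_univ, and_true]
      rintro rfl
      exact hfB hr
    nlinarith
  · have h2 : rowSum T i = 2 := by omega
    have h0 : ∑ r ∈ (Finset.univ.erase f).erase i, rowSum T r = 0 := by omega
    rw [Finset.sum_eq_zero_iff] at h0
    obtain ⟨j, k, hjk, he⟩ := Finset.card_eq_two.1 h2
    have hw : ∀ l, T i l = 1 ↔ l = j ∨ l = k := by
      intro l
      have := Finset.ext_iff.1 he l
      simpa using this
    have hif : i ≠ f := (Finset.mem_erase.1 hi).1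
    let σ := Equiv.swap j f
    let τ := Equiv.swap (σ k) i
    have hσj : σ j = f := Equiv.swap_apply_left _ _
    have hpk : τ (σ k) = i := Equiv.swap_apply_left _ _
    have hpj : τ (σ j) = f := by
      rw [hσj]
      apply Equiv.swap_apply_of_ne_of_ne
      · rw [← hσj]
        exact fun h => hjk (σ.injective h)
      · exact hif.symm
    apply cant_no_perm hT i
    refine ⟨σ.trans τ, fun l => ?_⟩
    simp only [Equiv.trans_apply]
    by_cases hlj : l = j
    · subst hlj
      rw [hpj, hf, (hw l).2 (Or.inl rfl)]
    by_cases hlk : l = k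
    · subst hlk
      rw [hpk]
    · have ha : T i l ≠ 1 := fun h => by
        rcases (hw l).1 h with h | h
        · exact hlj h
        · exact hlk h
      have hr1 : τ (σ l) ≠ f := by
        rw [← hpj]
        exact fun h => hlj (σ.injective (τ.injective h))
      have hr2 : τ (σ l) ≠ i := by
        intro h
        rw [← hpk] at h
        exact hlk (σ.injective (τ.injective h))
      have hz := h0 (τ (σ l)) (by simp [hr1, hr2])
      have hb : T (τ (σ l)) l ≠ 1 := by
        intro h
        have := Finset.card_eq_zero.1 hz
        have h5 := Finset.ext_iff.1 this l
        simp [h] at h5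
      omega

theorem case_zero {n d : ℕ} {T : Fin n → Fin n → Fin 2} (hT : Cantorian T)
    (hd1 : 1 ≤ d) (hd2 : d ≤ 2) (hn : d + 3 ≤ n) (hs : onesCount T = n + d)
    (i : Fin n) (hi : ∀ k, T i k = 0) : False := by
  classical
  have hno : ¬ ∃ π : Equiv.Perm (Fin n), ∀ k, π k ∈ Finset.univ.filter (fun r => T r k = 0) := by
    rintro ⟨π, hπ⟩
    apply cant_no_perm hT i
    refine ⟨π, fun k => ?_⟩
    have h1 := hπ k
    simp only [Finset.mem_filter, Finset.mem_univ, true_and] at h1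
    rw [h1, hi]
  obtain ⟨S, B, hc, hb⟩ := hallPerm _ hno
  have hb' : ∀ r ∈ B, ∀ k ∈ S, T r k = 1 := by
    intro r hr k hk
    have := hb r hr k hk
    simp only [Finset.mem_filter, Finset.mem_univ, true_and] at this
    exact fin2_ne this
  have hSn : S.card ≤ n := by simpa using Finset.card_le_univ S
  have hBn : B.card ≤ n := by simpa using Finset.card_le_univ B
  have hiB : i ∉ B := by
    intro h
    obtain ⟨k, hk⟩ := Finset.card_pos.1 (show 0 < S.card by omega)
    have := hb' i h k hk
    rw [hi] at this
    exact absurd this (by decide)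
  have hBn' : B.card < n := by simpa using Finset.card_lt_univ_of_notMem hiB
  by_cases hB1 : B.card = 1
  · obtain ⟨f, hf⟩ := Finset.card_eq_one.1 hB1
    have hSu : S = Finset.univ := Finset.eq_univ_of_card S (by rw [Fintype.card_fin]; omega)
    exact case_full hT hd1 hd2 hn hs f (fun k => hb' f (by simp [hf]) k (by simp [hSu]))
  · have h2 := block_le hb'
    have h3 : ∑ r ∈ B, rowSum T r ≤ ∑ r, rowSum T r :=
      Finset.sum_le_sum_of_subset (Finset.subset_univ B)
    rw [← onesCount_eq, hs] at h3
    obtain ⟨b, hb2⟩ : ∃ b, B.card = b + 2 := ⟨B.card - 2, by omega⟩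
    obtain ⟨s, hs2⟩ : ∃ s, S.card = s + 2 := ⟨S.card - 2, by omega⟩
    rw [hb2, hs2] at h2
    have : 0 ≤ b * s := Nat.zero_le _
    nlinarith

theorem main_aux {n d : ℕ} {T : Fin n → Fin n → Fin 2} (hT : Cantorian T)
    (hd1 : 1 ≤ d) (hd2 : d ≤ 2) (hn : d + 3 ≤ n) (hs : onesCount T = n + d) : False := by
  classical
  have hpos : ∀ r, 1 ≤ rowSum T r := by
    intro r
    by_contra hr
    have h0 : rowSum T r = 0 := by omega
    refine case_zero hT hd1 hd2 hn hs r (fun k => ?_)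
    have h5 := Finset.ext_iff.1 (Finset.card_eq_zero.1 h0) k
    simp only [Finset.mem_filter, Finset.mem_univ, true_and, Finset.notMem_empty, iff_false] at h5
    omega
  rw [onesCount_eq] at hs
  -- each single row yields an almost full column
  have hsing : ∀ i j, (∀ k, T i k = 1 ↔ k = j) → ∃ k, k ≠ j ∧ ∀ r, r ≠ i → T r k = 1 := by
    intro i j hij
    obtain ⟨S, B, hc, hfB, hjS, hS, hB, hb⟩ := lemX hT i i j hij ((hij j).2 rfl)
    have h2 := block_le hb
    have h3 : Bᶜ.card ≤ ∑ r ∈ Bᶜ, rowSum T r := by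
      have := Finset.card_nsmul_le_sum Bᶜ (rowSum T) 1 (fun r _ => hpos r)
      simpa using this
    have h4 := Finset.sum_add_sum_compl B (rowSum T)
    have h5 := Finset.card_add_card_compl B
    rw [Fintype.card_fin] at h5
    have hS1 : S.card = 1 := by
      by_contra hne
      obtain ⟨b, hb2⟩ : ∃ b, B.card = b + 1 := ⟨B.card - 1, by omega⟩
      obtain ⟨s, hs2⟩ : ∃ s, S.card = s + 2 := ⟨S.card - 2, by omega⟩
      rw [hb2, hs2] at h2
      have : 0 ≤ b * s := Nat.zero_le _
      nlinarith
    obtain ⟨k, hk⟩ := Finset.card_eq_one.1 hS1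
    refine ⟨k, ?_, ?_⟩
    · rintro rfl
      simp [hk] at hjS
    · intro r hr
      apply hb r _ k (by simp [hk])
      by_contra hrB
      have : (insert r (insert i B)).card ≤ n := by
        simpa using Finset.card_le_univ (insert r (insert i B))
      rw [Finset.card_insert_of_notMem (by simp [hr, hrB]),
        Finset.card_insert_of_notMem hfB] at this
      omega
  have hcard : 2 < (Finset.univ.filter (fun r => rowSum T r = 1)).card := by
    have h1 : ∑ r : Fin n, 2 ≤ ∑ r, (rowSum T r + if rowSum T r = 1 then 1 else 0) := by
      apply Finset.sum_le_sum
      intro r _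
      have := hpos r
      split_ifs <;> omega
    rw [Finset.sum_add_distrib, ← Finset.card_filter, hs] at h1
    simp only [Finset.sum_const, Finset.card_univ, Fintype.card_fin, smul_eq_mul] at h1
    omega
  obtain ⟨a, b, e, ha, hb, he, hab, hae, hbe⟩ := Finset.two_lt_card_iff.1 hcard
  simp only [Finset.mem_filter, Finset.mem_univ, true_and] at ha hb he
  obtain ⟨ja, hja⟩ := rowSum_one ha
  obtain ⟨jb, hjb⟩ := rowSum_one hb
  obtain ⟨je, hje⟩ := rowSum_one he
  obtain ⟨ka, hka, hka'⟩ := hsing a ja hja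
  obtain ⟨kb, hkb, hkb'⟩ := hsing b jb hjb
  have e1 := (hje ka).1 (hka' e hae.symm)
  have e2 := (hje kb).1 (hkb' e hbe.symm)
  have e3 := (hja kb).1 (hkb' a hab)
  exact hka (by rw [e1, ← e2, e3])

/-- `c (n, n+1) = 0` for `n ≥ 4`, and `c (n, n+2) = 0` for `n ≥ 5`. -/
theorem c_n_plus_one_two (n : ℕ) :
    (4 ≤ n → c n (n + 1) = 0) ∧ (5 ≤ n → c n (n + 2) = 0) := by
  constructor
  · intro hn
    have : IsEmpty {T : Fin n → Fin n → Fin 2 // Cantorian T ∧ onesCount T = n + 1} :=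
      ⟨fun T => main_aux T.2.1 (d := 1) (by omega) (by omega) (by omega) T.2.2⟩
    exact Nat.card_of_isEmpty
  · intro hn
    have : IsEmpty {T : Fin n → Fin n → Fin 2 // Cantorian T ∧ onesCount T = n + 2} :=
      ⟨fun T => main_aux T.2.1 (d := 2) (by omega) (by omega) (by omega) T.2.2⟩
    exact Nat.card_of_isEmpty
end

section
/- For every n ≥ 3, the n×n tableau over {0,1} whose last row is the constant word 1^n, whose (n−1)-st row has entries 1 in the last three columns and 0 elsewhere, and whose remaining rows are the constant word 0^n (so that exactly n+3 entries equal 1) is Cantorian; consequently c(n,n+3) ≥ 1 for all n ≥ 3. -/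
theorem aux_cantorian (n : ℕ) (hn : 3 ≤ n) :
    Cantorian (fun i j : Fin n =>
        if i.val = n - 1 then 1
        else if i.val = n - 2 ∧ n - 3 ≤ j.val then 1 else (0 : Fin 2)) := by
  unfold Cantorian
  rw [Set.eq_empty_iff_forall_notMem]
  rintro w ⟨⟨i, rfl⟩, π, h⟩
  have key : i.val = n - 1 ∨ i.val = n - 2 := by
    have h1 := h (π.symm ⟨n - 1, by omega⟩)
    by_contra hc
    push Not at hc
    simp [hc.1, hc.2] at h1
  have h2 : ∀ j : Fin n, n - 3 ≤ j.val → (π j).val = n - 1 ∨ (π j).val = n - 2 := by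
    intro j hj
    have h1 := h j
    by_contra hc
    push Not at hc
    rcases key with k | k <;> simp [hc.1, hc.2, k, hj] at h1
  have inj : ∀ j k : Fin n, (π j).val = (π k).val → j.val = k.val := by
    intro j k e
    rw [π.injective (Fin.ext e)]
  have a := h2 ⟨n - 1, by omega⟩ (by simp; omega)
  have b := h2 ⟨n - 2, by omega⟩ (by simp; omega)
  have c := h2 ⟨n - 3, by omega⟩ (by simp)
  have ab := inj ⟨n - 1, by omega⟩ ⟨n - 2, by omega⟩
  have bc := inj ⟨n - 2, by omega⟩ ⟨n - 3, by omega⟩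
  have ac := inj ⟨n - 1, by omega⟩ ⟨n - 3, by omega⟩
  simp only at ab bc ac
  omega

theorem aux_count (n : ℕ) (hn : 3 ≤ n) :
    onesCount (fun i j : Fin n =>
        if i.val = n - 1 then 1
        else if i.val = n - 2 ∧ n - 3 ≤ j.val then 1 else (0 : Fin 2)) = n + 3 := by
  unfold onesCount
  have e : (Finset.univ.filter (fun p : Fin n × Fin n =>
      (if p.1.val = n - 1 then 1
        else if p.1.val = n - 2 ∧ n - 3 ≤ p.2.val then 1 else (0 : Fin 2)) = 1)) =
      (({⟨n - 1, by omega⟩} : Finset (Fin n)) ×ˢ (Finset.univ : Finset (Fin n))) ∪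
      (({⟨n - 2, by omega⟩} : Finset (Fin n)) ×ˢ
        Finset.Ici (⟨n - 3, by omega⟩ : Fin n)) := by
    ext ⟨i, j⟩
    simp only [Finset.mem_filter, Finset.mem_univ, true_and, Finset.mem_union,
      Finset.mem_product, Finset.mem_singleton, Finset.mem_Ici, Fin.ext_iff, Fin.le_def,
      and_true]
    split_ifs <;> simp_all
  rw [e, Finset.card_union_of_disjoint]
  · simp
    omega
  · rw [Finset.disjoint_left]
    rintro ⟨i, j⟩ h1 h2
    simp [Fin.ext_iff] at h1 h2
    omega

/-- For `n ≥ 3`, the tableau whose last row is `1ⁿ`, whose `(n-1)`-st row has `1`'s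
in the last three columns and `0`'s elsewhere, and whose remaining rows are `0ⁿ`
has exactly `n + 3` ones and is Cantorian; hence `c (n, n+3) ≥ 1`. -/
theorem c_n_plus_three_pos (n : ℕ) (hn : 3 ≤ n) :
    Cantorian (fun i j : Fin n =>
        if i.val = n - 1 then 1
        else if i.val = n - 2 ∧ n - 3 ≤ j.val then 1 else (0 : Fin 2)) ∧
    onesCount (fun i j : Fin n =>
        if i.val = n - 1 then 1
        else if i.val = n - 2 ∧ n - 3 ≤ j.val then 1 else (0 : Fin 2)) = n + 3 ∧
    1 ≤ c n (n + 3) := by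
  refine ⟨aux_cantorian n hn, aux_count n hn, ?_⟩
  unfold c
  haveI : Nonempty {T : Fin n → Fin n → Fin 2 // Cantorian T ∧ onesCount T = n + 3} :=
    ⟨⟨_, aux_cantorian n hn, aux_count n hn⟩⟩
  exact Nat.card_pos
end

section
/- Let N(n) be the number of non-Cantorian n×n tableaux over the two-letter alphabet {0,1}. Then N(n) ≥ 2^{n²−n+1} for every n ≥ 1. -/
/-- `N n` is the number of non-Cantorian `n × n` tableaux over `{0,1}`. -/
noncomputable def N (n : ℕ) : ℕ :=
  Nat.card {T : Fin n → Fin n → Fin 2 // ¬ Cantorian T}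

/-- The number of non-Cantorian `n × n` tableaux over `{0,1}` is at least
`2 ^ (n² - n + 1)`. -/
theorem nonCantorian_lower_bound (n : ℕ) (hn : 1 ≤ n) :
    2 ^ (n ^ 2 - n + 1) ≤ N n := by
  obtain ⟨m, rfl⟩ : ∃ m, n = m + 1 := ⟨n - 1, by omega⟩
  let g : (Fin (m+1) → Fin (m+1) → Fin 2) → (Fin (m+1) → Fin (m+1) → Fin 2) :=
    fun T i j => if i = j then T 0 j else T i j
  have hg : ∀ T, ¬ Cantorian (g T) := by
    intro T h
    have hmem : g T 0 ∈ Set.range (fun i => g T i) ∩ TPerm (g T) := by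
      refine ⟨⟨0, rfl⟩, Equiv.refl _, fun j => ?_⟩
      simp [g]
    unfold Cantorian at h
    rw [h] at hmem
    exact hmem
  let f : (Fin (m+1) → Fin (m+1) → Fin 2) →
      {T : Fin (m+1) → Fin (m+1) → Fin 2 // ¬ Cantorian T} × (Fin m → Fin 2) :=
    fun T => (⟨g T, hg T⟩, fun k => T k.succ k.succ)
  have hf : Function.Injective f := by
    intro S T h
    have h1 : g S = g T := congrArg (fun x => x.1.1) h
    have h2 : ∀ k : Fin m, S k.succ k.succ = T k.succ k.succ :=
      fun k => congrFun (congrArg (fun x => x.2) h) k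
    funext i j
    by_cases hij : i = j
    · subst hij
      refine Fin.cases ?_ (fun k => h2 k) i
      have := congrFun (congrFun h1 0) 0
      simpa [g] using this
    · have := congrFun (congrFun h1 i) j
      simpa [g, hij] using this
  have hc := Nat.card_le_card_of_injective f hf
  rw [Nat.card_prod] at hc
  change _ ≤ N (m+1) * _ at hc
  simp only [Nat.card_eq_fintype_card, Fintype.card_fun, Fintype.card_fin] at hc
  rw [← pow_mul] at hc
  have e : (m+1) * (m+1) = ((m+1)^2 - (m+1) + 1) + m := by
    have : (m+1)^2 = m*m + m + (m+1) := by ring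
    rw [this, Nat.add_sub_cancel]; ring
  rw [e, pow_add] at hc
  exact Nat.le_of_mul_le_mul_right hc (by positivity)
end

section
/- Let C(n) be the number of Cantorian n×n tableaux over the two-letter alphabet {0,1}. Then 1/2 ≤ liminf_{n→∞} (log C(n))/(n² log 2) and limsup_{n→∞} (log C(n))/(n² log 2) ≤ 1. -/
open Filter

/-- `C n` is the number of Cantorian `n × n` tableaux over `{0,1}`. -/
noncomputable def C (n : ℕ) : ℕ :=
  Nat.card {T : Fin n → Fin n → Fin 2 // Cantorian T}


def mkT (n : ℕ) (f : Fin n → Fin (n/2-1) → Fin 2) : Fin n → Fin n → Fin 2 :=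
  fun i j => if h : j.val < n/2-1 then f i ⟨j.val, h⟩ else if i.val < n/2 then 0 else 1

theorem mkT_cantorian (n : ℕ) (f : Fin n → Fin (n/2-1) → Fin 2) (hn : 2 ≤ n) :
    Cantorian (mkT n f) := by
  unfold Cantorian
  rw [Set.eq_empty_iff_forall_notMem]
  rintro w ⟨⟨i, rfl⟩, π, hπ⟩
  have key : ∀ j : Fin n, n/2-1 ≤ j.val → (i.val < n/2 ↔ (π j).val < n/2) := by
    intro j hj
    have h := hπ j
    simp only [mkT, dif_neg (not_lt.mpr hj)] at h
    split_ifs at h <;> first | omega | simp_all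
  let g : Fin (n - (n/2-1)) → Fin n := fun a => π ⟨a.val + (n/2-1), by have := a.2; omega⟩
  have hg : Function.Injective g := by
    intro a b hab
    have := π.injective hab
    simp only [Fin.mk.injEq] at this
    exact Fin.ext (by omega)
  by_cases hi : i.val < n/2
  · let g' : Fin (n - (n/2-1)) → Fin (n/2) := fun a => ⟨(g a).val, (key _ (by simp)).1 hi⟩
    have : Function.Injective g' := fun a b hab => hg (Fin.ext (by simpa [g'] using hab))
    have := Fintype.card_le_of_injective g' this
    simp only [Fintype.card_fin] at this
    omega
  · have hb : ∀ a, n/2 ≤ (g a).val := fun a => by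
      by_contra hc
      exact hi ((key _ (by simp)).2 (not_le.mp hc))
    let g' : Fin (n - (n/2-1)) → Fin (n - n/2) :=
      fun a => ⟨(g a).val - n/2, by have := hb a; have := (g a).2; omega⟩
    have : Function.Injective g' := fun a b hab => hg (Fin.ext (by
      have h1 : (g a).val - n/2 = (g b).val - n/2 := congrArg Fin.val hab
      have := hb a
      have := hb b
      omega))
    have := Fintype.card_le_of_injective g' this
    simp only [Fintype.card_fin] at this
    omega

theorem C_lower (n : ℕ) (hn : 2 ≤ n) : 2 ^ (n * (n/2-1)) ≤ C n := by
  have hinj : Function.Injective (fun f : Fin n → Fin (n/2-1) → Fin 2 =>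
      (⟨mkT n f, mkT_cantorian n f hn⟩ : {T : Fin n → Fin n → Fin 2 // Cantorian T})) := by
    intro f g hfg
    have h1 : mkT n f = mkT n g := congrArg Subtype.val hfg
    funext i j
    have h2 := congrFun (congrFun h1 i) ⟨j.val, by have := j.2; omega⟩
    simpa [mkT] using h2
  have := Nat.card_le_card_of_injective _ hinj
  simp only [Nat.card_eq_fintype_card, Fintype.card_fun, Fintype.card_fin] at this
  rw [← pow_mul, mul_comm] at this
  simpa [C, Nat.card_eq_fintype_card] using this

theorem C_upper (n : ℕ) : C n ≤ 2 ^ (n ^ 2) := by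
  have := Nat.card_le_card_of_injective
    (Subtype.val : {T : Fin n → Fin n → Fin 2 // Cantorian T} → _) Subtype.val_injective
  rw [Nat.card_eq_fintype_card (α := Fin n → Fin n → Fin 2)] at this
  simp only [Fintype.card_fun, Fintype.card_fin] at this
  rw [← pow_mul, ← sq] at this
  exact this

theorem ratio_upper (n : ℕ) : Real.log (C n) / ((n : ℝ) ^ 2 * Real.log 2) ≤ 1 := by
  have h2 : 0 < Real.log 2 := Real.log_pos (by norm_num)
  apply div_le_one_of_le₀ _ (by positivity)
  rcases Nat.eq_zero_or_pos (C n) with h | h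
  · rw [h]; simp; positivity
  · have : (C n : ℝ) ≤ 2 ^ (n^2) := by exact_mod_cast C_upper n
    have := Real.log_le_log (by exact_mod_cast h) this
    rw [Real.log_pow] at this
    exact_mod_cast this

theorem ratio_nonneg (n : ℕ) : 0 ≤ Real.log (C n) / ((n : ℝ) ^ 2 * Real.log 2) := by
  have h2 : 0 < Real.log 2 := Real.log_pos (by norm_num)
  have := Real.log_natCast_nonneg (C n)
  positivity

theorem ratio_lower (n : ℕ) (hn : 2 ≤ n) :
    1/2 - (3/2) / (n:ℝ) ≤ Real.log (C n) / ((n : ℝ) ^ 2 * Real.log 2) := by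
  have h2 : 0 < Real.log 2 := Real.log_pos (by norm_num)
  have hn0 : (0:ℝ) < n := by exact_mod_cast (by omega : 0 < n)
  have h : (2:ℝ) ^ (n * (n/2-1)) ≤ C n := by exact_mod_cast C_lower n hn
  have h := Real.log_le_log (by positivity) h
  rw [Real.log_pow] at h
  rw [le_div_iff₀ (by positivity)]
  refine le_trans ?_ h
  have h3 : (n:ℝ) ≤ 2 * ((n/2-1 : ℕ) : ℝ) + 3 := by
    exact_mod_cast (by omega : n ≤ 2 * (n/2-1) + 3)
  have h4 : (1/2 - (3/2) / (n:ℝ)) * ((n : ℝ) ^ 2 * Real.log 2)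
      = (n * ((n - 3)/2)) * Real.log 2 := by
    field_simp
  rw [h4]
  push_cast
  gcongr
  linarith

/-- `1/2 ≤ liminf (log C(n)) / (n² log 2)` and `limsup (log C(n)) / (n² log 2) ≤ 1`. -/
theorem log_cantorian_bounds :
    (1 / 2 : ℝ) ≤
        atTop.liminf (fun n : ℕ => Real.log (C n) / ((n : ℝ) ^ 2 * Real.log 2)) ∧
      atTop.limsup (fun n : ℕ => Real.log (C n) / ((n : ℝ) ^ 2 * Real.log 2)) ≤ 1 := by
  have hbA : IsBoundedUnder (· ≤ ·) atTop
      (fun n : ℕ => Real.log (C n) / ((n : ℝ) ^ 2 * Real.log 2)) :=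
    isBoundedUnder_of ⟨1, ratio_upper⟩
  have hbB : IsBoundedUnder (· ≥ ·) atTop
      (fun n : ℕ => Real.log (C n) / ((n : ℝ) ^ 2 * Real.log 2)) :=
    isBoundedUnder_of ⟨0, ratio_nonneg⟩
  constructor
  · have ht : Tendsto (fun n : ℕ => 1/2 - (3/2) / (n:ℝ)) atTop (nhds (1/2)) := by
      simpa using (tendsto_const_nhds (x := (1/2:ℝ))).sub (tendsto_const_div_atTop_nhds_zero_nat (3/2:ℝ))
    rw [← ht.liminf_eq]
    exact liminf_le_liminf ((eventually_ge_atTop 2).mono ratio_lower)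
      ht.isBoundedUnder_ge hbA.isCoboundedUnder_ge
  · exact limsup_le_of_le hbB.isCoboundedUnder_le (Eventually.of_forall ratio_upper)
end

section
/- Let T be an infinite tableau over an alphabet A with rows l_0, l_1, l_2, …, and for each i ∈ ℕ let σ_i : A → A be a fixed-point-free map. Then: (1) Perm(T) is disjoint from the set {σ_i ∘ l_i : i ∈ ℕ}; (2) Perm(σ̄T) is disjoint from L(T), where σ̄T is the infinite tableau whose i-th row is σ_i ∘ l_i; and (3) if the set {σ_i ∘ l_i : i ∈ ℕ} equals L(T), then T is Cantorian. -/
/-- The permanent of an infinite tableau `T : ℕ → ℕ → A`: the set of sequences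
`w : ℕ → A` such that `w j = T (π j) j` for some bijection `π : ℕ → ℕ`. -/
def IPerm {A : Type*} (T : ℕ → ℕ → A) : Set (ℕ → A) :=
  {w | ∃ π : ℕ ≃ ℕ, ∀ j, w j = T (π j) j}

/-- An infinite tableau is Cantorian if no row belongs to its permanent. -/
def ICantorian {A : Type*} (T : ℕ → ℕ → A) : Prop :=
  Set.range (fun i => T i) ∩ IPerm T = ∅

/-- Infinite version of the sufficient condition: if each `σᵢ : A → A` is
fixed-point free, then (1) `Perm T` is disjoint from `{σᵢ ∘ lᵢ}`; (2) `Perm (σ̄T)`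
is disjoint from `L(T)`; and (3) if `{σᵢ ∘ lᵢ} = L(T)` then `T` is Cantorian. -/
theorem infinite_sufficient_condition {A : Type*} (T : ℕ → ℕ → A)
    (σ : ℕ → A → A) (hσ : ∀ i : ℕ, ∀ a : A, σ i a ≠ a) :
    IPerm T ∩ Set.range (fun i : ℕ => σ i ∘ T i) = ∅ ∧
    IPerm (fun i j : ℕ => σ i (T i j)) ∩ Set.range (fun i : ℕ => T i) = ∅ ∧
    (Set.range (fun i : ℕ => σ i ∘ T i) = Set.range (fun i : ℕ => T i) →
      ICantorian T) := by
  have h1 : IPerm T ∩ Set.range (fun i : ℕ => σ i ∘ T i) = ∅ := by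
    rw [Set.eq_empty_iff_forall_notMem]
    rintro w ⟨⟨π, hπ⟩, ⟨i, hi⟩⟩
    have h := hπ (π.symm i)
    rw [← hi, Equiv.apply_symm_apply] at h
    exact hσ i _ h
  refine ⟨h1, ?_, ?_⟩
  · rw [Set.eq_empty_iff_forall_notMem]
    rintro w ⟨⟨π, hπ⟩, ⟨i, hi⟩⟩
    have h := hπ (π.symm i)
    rw [← hi, Equiv.apply_symm_apply] at h
    exact hσ i _ h.symm
  · intro h
    unfold ICantorian
    rw [← h, Set.inter_comm]
    exact h1
end

section
/- Let L be the set of real algebraic numbers in the unit interval [0,1], and let T be an infinite tableau over the alphabet Fin 2 whose rows are exactly the binary digit sequences of elements of L, i.e., a sequence d : ℕ → Fin 2 is a row of T if and only if val_2(d) is algebraic and lies in [0,1]. Then {val_2(p) : p ∈ Perm(T)} is exactly the set of transcendental numbers in [0,1]. -/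
/-- The real number in `[0,1]` represented by the binary digit sequence `d`. -/
noncomputable def valTwo (d : ℕ → Fin 2) : ℝ :=
  ∑' j : ℕ, (d j : ℝ) / (2 : ℝ) ^ (j + 1)

theorem val_summable (d : ℕ → Fin 2) :
    Summable (fun j : ℕ => (d j : ℝ) / (2 : ℝ) ^ (j + 1)) := by
  refine Summable.of_nonneg_of_le (fun j => by positivity) (fun j => ?_)
    ((summable_geometric_two' (1 : ℝ)))
  have h : (d j : ℝ) ≤ 1 := by
    have := (d j).isLt
    exact_mod_cast (by omega : (d j : ℕ) ≤ 1)
  rw [pow_succ', div_div]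
  gcongr

theorem val_mem (d : ℕ → Fin 2) : valTwo d ∈ Set.Icc (0 : ℝ) 1 := by
  refine ⟨tsum_nonneg fun j => by positivity, ?_⟩
  rw [← tsum_geometric_two' (1 : ℝ)]
  refine (val_summable d).tsum_le_tsum (fun j => ?_) (summable_geometric_two' (1 : ℝ))
  have h : (d j : ℝ) ≤ 1 := by
    have := (d j).isLt
    exact_mod_cast (by omega : (d j : ℕ) ≤ 1)
  rw [pow_succ', div_div]
  gcongr

theorem val_compl (d : ℕ → Fin 2) : valTwo (fun j => 1 - d j) = 1 - valTwo d := by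
  rw [eq_sub_iff_add_eq, ← tsum_geometric_two' (1 : ℝ)]
  unfold valTwo
  rw [← (val_summable (fun j => 1 - d j)).tsum_add (val_summable d)]
  congr 1
  funext j
  rw [pow_succ', div_div, ← add_div]
  congr 1
  generalize d j = a
  fin_cases a <;> simp

theorem val_fin (d e : ℕ → Fin 2) (h : {j | d j ≠ e j}.Finite)
    (ha : IsAlgebraic ℚ (valTwo d)) : IsAlgebraic ℚ (valTwo e) := by
  have : valTwo e = valTwo d +
      ∑ j ∈ h.toFinset, ((e j : ℝ) / (2 : ℝ) ^ (j + 1) - (d j : ℝ) / (2 : ℝ) ^ (j + 1)) := by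
    rw [← sub_eq_iff_eq_add']
    unfold valTwo
    rw [← (val_summable e).tsum_sub (val_summable d)]
    apply tsum_eq_sum
    intro j hj
    simp at hj
    simp [hj]
  rw [this]
  refine ha.add ?_
  have : (∑ j ∈ h.toFinset, ((e j : ℝ) / (2 : ℝ) ^ (j + 1) - (d j : ℝ) / (2 : ℝ) ^ (j + 1)))
    = algebraMap ℚ ℝ (∑ j ∈ h.toFinset,
      (((e j : ℕ) : ℚ) / (2 : ℚ) ^ (j + 1) - ((d j : ℕ) : ℚ) / (2 : ℚ) ^ (j + 1))) := by
    simp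
  rw [this]
  exact isAlgebraic_algebraMap _

theorem alg_compl {x : ℝ} (h : IsAlgebraic ℚ (1 - x)) : IsAlgebraic ℚ x := by
  have := (isAlgebraic_one (R := ℚ) (A := ℝ)).sub h
  simpa using this

theorem fin2_ne_s19 {a b : Fin 2} (h : a ≠ b) : 1 - a = b := by
  revert a b; decide

theorem exists_bij (R : ℕ → ℕ → Prop) (h1 : ∀ j, ∃ᶠ i in Filter.atTop, R j i)
    (h2 : ∀ i, ∃ᶠ j in Filter.atTop, R j i) : ∃ π : ℕ ≃ ℕ, ∀ j, R j (π j) := by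
  obtain ⟨f, hf, hfR⟩ := Filter.extraction_forall_of_frequently h1
  obtain ⟨g, hg, hgR⟩ := Filter.extraction_forall_of_frequently h2
  obtain ⟨h, hb, hR⟩ := Function.Embedding.schroeder_bernstein_of_rel
    hf.injective hg.injective R hfR hgR
  exact ⟨Equiv.ofBijective h hb, hR⟩

theorem perm_of_algebraic_is_transcendental (T : ℕ → ℕ → Fin 2)
    (hrows : ∀ d : ℕ → Fin 2, d ∈ Set.range (fun i => T i) ↔
      (IsAlgebraic ℚ (valTwo d) ∧ valTwo d ∈ Set.Icc (0 : ℝ) 1)) :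
    valTwo '' IPerm T = {x : ℝ | x ∈ Set.Icc (0 : ℝ) 1 ∧ Transcendental ℚ x} := by
  have hrow : ∀ d, IsAlgebraic ℚ (valTwo d) → ∃ i, T i = d :=
    fun d hd => (hrows d).2 ⟨hd, val_mem d⟩
  have halg : ∀ i, IsAlgebraic ℚ (valTwo (T i)) := fun i => ((hrows (T i)).1 ⟨i, rfl⟩).1
  ext x
  constructor
  · rintro ⟨p, ⟨π, hπ⟩, rfl⟩
    refine ⟨val_mem p, fun ha => ?_⟩
    obtain ⟨i, hi⟩ := hrow (fun j => 1 - p j) (by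
      rw [val_compl]; exact isAlgebraic_one.sub ha)
    have h := hπ (π.symm i)
    rw [Equiv.apply_symm_apply, hi] at h
    revert h
    beta_reduce
    generalize p (π.symm i) = a
    revert a
    decide
  · rintro ⟨hx, ht⟩
    have hx1 : x ≠ 1 := by
      rintro rfl
      exact ht isAlgebraic_one
    obtain ⟨w, rfl⟩ : ∃ w, valTwo w = x := by
      refine ⟨Real.digits x 2, ?_⟩
      have := Real.ofDigits_digits (b := 2) (x := x) (by norm_num) ⟨hx.1, lt_of_le_of_ne hx.2 hx1⟩
      refine Eq.trans ?_ this
      unfold valTwo Real.ofDigits Real.ofDigitsTerm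
      simp [div_eq_mul_inv]
    refine ⟨w, exists_bij (fun j i => w j = T i j) (fun j => ?_) (fun i => ?_), rfl⟩
    · rw [Nat.frequently_atTop_iff_infinite]
      have hz : IsAlgebraic ℚ (valTwo (fun _ => 0)) := by
        simpa [valTwo] using isAlgebraic_zero
      have : ∀ k, ∃ i, T i = fun n => if n = j then w j else if n = j + 1 + k then 1 else 0 := by
        intro k
        refine hrow _ (val_fin _ _ ?_ hz)
        refine (Set.toFinite {j, j + 1 + k}).subset ?_
        intro n hn
        by_contra hc
        simp at hc
        simp [hc] at hn
      choose f hf using this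
      refine Set.infinite_of_injective_forall_mem (f := f) ?_ ?_
      · intro k l hkl
        have h1 := congrFun (hf k) (j + 1 + k)
        rw [hkl, hf l] at h1
        have : j + 1 + k ≠ j := by omega
        simp [this] at h1
        exact h1
      · intro k
        simp [hf k]
    · intro hfin
      rw [Filter.eventually_atTop] at hfin
      obtain ⟨N, hN⟩ := hfin
      apply ht
      apply alg_compl
      rw [← val_compl]
      refine val_fin (T i) _ ?_ (halg i)
      refine (Set.finite_lt_nat N).subset ?_
      intro j hj
      by_contra hc
      simp at hc
      exact hj (fin2_ne_s19 (hN j hc)).symm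
end
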